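/- arXiv:2305.10365 — 4 statements merged into one kernel-verified Lean document; each statement's English description precedes it below -/
import Mathlib

section
/- Discrete sewing lemma: Let (B, ‖·‖) be a normed vector space, let n ≥ 1 and let t_0 < t_1 < ⋯ < t_n be real numbers, and write G = {t_0, …, t_n}. Let ω be a control on G, let μ > 1 be a real number, and let R assign to every pair (s,t) of points of G with s ≤ t an element R(s,t) ∈ B. Assume: (i) ‖R(t_k, t_{k+1})‖ ≤ ω(t_k, t_{k+1})^μ for every 0 ≤ k < n, and (ii) ‖R(s,t) − R(s,u) − R(u,t)‖ ≤ ω(s,t)^μ for all points s ≤ u ≤ t of G. Then for all points s ≤ t of G one has ‖R(s,t)‖ ≤ K_μ · ω(s,t)^μ, where K_μ = 2^μ · ∑_{l=1}^∞ l^{−μ}. -/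
open Finset in
/-- Removing the point `p (i + 1)` from the partition `p 0, …, p (i + r + 2)` changes the Riemann
sum only through the terms adjacent to that point. -/
theorem sum_steps_remove_point {α B : Type*} [AddCommGroup B] (R : α → α → B) (p : ℕ → α)
    (i r : ℕ) :
    ∑ j ∈ range (i + 1 + r), R (if j ≤ i then p j else p (j + 1))
        (if j + 1 ≤ i then p (j + 1) else p (j + 1 + 1)) =
      ∑ j ∈ range (i + 2 + r), R (p j) (p (j + 1)) +
        (R (p i) (p (i + 2)) - R (p i) (p (i + 1)) - R (p (i + 1)) (p (i + 2))) := by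
  rw [sum_range_add _ (i + 1) r, sum_range_add _ (i + 2) r, sum_range_succ _ i,
    sum_range_succ _ (i + 1), sum_range_succ _ i]
  have hleft : ∑ j ∈ range i, R (if j ≤ i then p j else p (j + 1))
      (if j + 1 ≤ i then p (j + 1) else p (j + 1 + 1)) = ∑ j ∈ range i, R (p j) (p (j + 1)) := by
    refine sum_congr rfl fun j hj => ?_
    have hji := mem_range.mp hj
    rw [if_pos hji.le, if_pos (Nat.succ_le_of_lt hji)]
  have hright : ∑ j ∈ range r, R (if i + 1 + j ≤ i then p (i + 1 + j) else p (i + 1 + j + 1))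
      (if i + 1 + j + 1 ≤ i then p (i + 1 + j + 1) else p (i + 1 + j + 1 + 1)) =
      ∑ j ∈ range r, R (p (i + 2 + j)) (p (i + 2 + j + 1)) := by
    refine sum_congr rfl fun j _ => ?_
    rw [if_neg (by omega), if_neg (by omega), show i + 1 + j + 1 = i + 2 + j by omega]
  rw [hleft, hright, if_pos le_rfl, if_neg (by omega)]
  abel

section Control

variable {α : Type*} [Preorder α] {ω : α → α → ℝ} {p : ℕ → α}

open Finset in
theorem control_sum_two_steps_le (h_nonneg : ∀ a b, a ≤ b → 0 ≤ ω a b)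
    (h_super : ∀ a b c, a ≤ b → b ≤ c → ω a b + ω b c ≤ ω a c) (hp : Monotone p) (N : ℕ) :
    ∑ i ∈ range N, ω (p i) (p (i + 2)) ≤ ω (p 0) (p (N + 1)) + ω (p 0) (p N) := by
  induction N with
  | zero =>
    simpa using add_nonneg (h_nonneg _ _ (hp (Nat.zero_le 1))) (h_nonneg _ _ (le_refl (p 0)))
  | succ N ih =>
    rw [sum_range_succ]
    linarith [h_super _ _ _ (hp (Nat.zero_le N)) (hp (show N ≤ N + 2 by omega))]

open Finset in
theorem exists_control_two_steps_le (h_nonneg : ∀ a b, a ≤ b → 0 ≤ ω a b)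
    (h_super : ∀ a b c, a ≤ b → b ≤ c → ω a b + ω b c ≤ ω a c) (hp : Monotone p) (N : ℕ) :
    ∃ i ≤ N, ω (p i) (p (i + 2)) ≤ 2 * ((N : ℝ) + 1)⁻¹ * ω (p 0) (p (N + 2)) := by
  have hsum := control_sum_two_steps_le h_nonneg h_super hp (N + 1)
  have hsup := h_super _ _ _ (hp (Nat.zero_le (N + 1))) (hp (show N + 1 ≤ N + 2 by omega))
  have hstep := h_nonneg _ _ (hp (show N + 1 ≤ N + 2 by omega))
  have hN : (0 : ℝ) < N + 1 := by positivity
  obtain ⟨i, hi, hle⟩ := exists_le_of_sum_le (s := range (N + 1)) (by simp)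
    (f := fun i => ω (p i) (p (i + 2)))
    (g := fun _ => 2 * ((N : ℝ) + 1)⁻¹ * ω (p 0) (p (N + 2))) (by
      rw [sum_const, card_range, nsmul_eq_mul]
      push_cast
      field_simp
      linarith)
  exact ⟨i, Nat.lt_succ_iff.mp (mem_range.mp hi), hle⟩

open Finset in
theorem control_sum_rpow_le (h_nonneg : ∀ a b, a ≤ b → 0 ≤ ω a b)
    (h_super : ∀ a b c, a ≤ b → b ≤ c → ω a b + ω b c ≤ ω a c) (hp : Monotone p)
    {μ : ℝ} (hμ : 1 ≤ μ) (m : ℕ) :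
    ∑ k ∈ range m, ω (p k) (p (k + 1)) ^ μ ≤ ω (p 0) (p m) ^ μ := by
  induction m with
  | zero => simpa using Real.rpow_nonneg (h_nonneg _ _ (le_refl (p 0))) μ
  | succ m ih =>
    have h0 := h_nonneg _ _ (hp (Nat.zero_le m))
    have h1 := h_nonneg _ _ (hp (Nat.le_succ m))
    rw [sum_range_succ]
    calc _ ≤ ω (p 0) (p m) ^ μ + ω (p m) (p (m + 1)) ^ μ := by gcongr
      _ ≤ (ω (p 0) (p m) + ω (p m) (p (m + 1))) ^ μ := Real.add_rpow_le_rpow_add h0 h1 hμ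
      _ ≤ _ := Real.rpow_le_rpow (add_nonneg h0 h1)
        (h_super _ _ _ (hp (Nat.zero_le m)) (hp (Nat.le_succ m))) (by linarith)

open Finset in
/-- Point-removal estimate of L. C. Young. -/
theorem norm_sub_sum_steps_le {B : Type*} [NormedAddCommGroup B] {R : α → α → B} {μ : ℝ}
    (hμ : 1 ≤ μ) (h_nonneg : ∀ a b, a ≤ b → 0 ≤ ω a b)
    (h_super : ∀ a b c, a ≤ b → b ≤ c → ω a b + ω b c ≤ ω a c)
    (h_delta : ∀ a b c, a ≤ b → b ≤ c → ‖R a c - R a b - R b c‖ ≤ ω a c ^ μ)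
    (m : ℕ) (hp : Monotone p) :
    ‖R (p 0) (p (m + 2)) - ∑ k ∈ range (m + 2), R (p k) (p (k + 1))‖ ≤
      (2 ^ μ * ∑ l ∈ range (m + 1), ((l : ℝ) + 1) ^ (-μ) - 1) * ω (p 0) (p (m + 2)) ^ μ := by
  induction m generalizing p with
  | zero =>
    have h2 : (2 : ℝ) ≤ 2 ^ μ := Real.self_le_rpow_of_one_le one_le_two hμ
    have hω : 0 ≤ ω (p 0) (p 2) ^ μ := Real.rpow_nonneg (h_nonneg _ _ (hp (Nat.zero_le 2))) μ
    have hd := h_delta _ _ _ (hp (Nat.zero_le 1)) (hp one_le_two)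
    rw [sub_sub] at hd
    simp only [zero_add, sum_range_succ, range_zero, sum_empty, Nat.cast_zero, Real.one_rpow,
      mul_one, one_add_one_eq_two]
    nlinarith
  | succ m ih =>
    obtain ⟨i, hi, hle⟩ := exists_control_two_steps_le h_nonneg h_super hp (m + 1)
    obtain ⟨r, hr⟩ := Nat.exists_eq_add_of_le hi
    have hq : Monotone fun j => if j ≤ i then p j else p (j + 1) := by
      intro a b hab
      dsimp only
      split_ifs <;> exact hp (by omega)
    have key := ih hq
    rw [show m + 2 = i + 1 + r by omega, sum_steps_remove_point R p i r,
      if_pos (Nat.zero_le i), if_neg (by omega), show i + 1 + r + 1 = m + 1 + 2 by omega,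
      show i + 2 + r = m + 1 + 2 by omega, ← sub_sub] at key
    have hω := h_nonneg _ _ (hp (Nat.zero_le (m + 1 + 2)))
    have hωi := h_nonneg _ _ (hp (show i ≤ i + 2 by omega))
    have hrem : ‖R (p i) (p (i + 2)) - R (p i) (p (i + 1)) - R (p (i + 1)) (p (i + 2))‖ ≤
        2 ^ μ * (((m + 1 : ℕ) : ℝ) + 1) ^ (-μ) * ω (p 0) (p (m + 1 + 2)) ^ μ := by
      refine (h_delta _ _ _ (hp (Nat.le_succ i)) (hp (Nat.le_succ (i + 1)))).trans
        ((Real.rpow_le_rpow hωi hle (by linarith)).trans_eq ?_)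
      rw [Real.mul_rpow (by positivity) hω, Real.mul_rpow (by positivity) (by positivity),
        Real.rpow_neg (by positivity), Real.inv_rpow (by positivity)]
    rw [sum_range_succ (fun l : ℕ => ((l : ℝ) + 1) ^ (-μ)) (m + 1)]
    refine (norm_le_norm_sub_add _ _).trans ((add_le_add key hrem).trans_eq ?_)
    ring

open Finset in
theorem norm_le_of_norm_step_le {B : Type*} [NormedAddCommGroup B] {R : α → α → B} {μ : ℝ}
    (hμ : 1 < μ) (h_nonneg : ∀ a b, a ≤ b → 0 ≤ ω a b)
    (h_super : ∀ a b c, a ≤ b → b ≤ c → ω a b + ω b c ≤ ω a c)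
    (h_delta : ∀ a b c, a ≤ b → b ≤ c → ‖R a c - R a b - R b c‖ ≤ ω a c ^ μ)
    (m : ℕ) (hp : Monotone p)
    (h_step : ∀ k < m, ‖R (p k) (p (k + 1))‖ ≤ ω (p k) (p (k + 1)) ^ μ) :
    ‖R (p 0) (p m)‖ ≤ (2 ^ μ * ∑' l : ℕ, ((l : ℝ) + 1) ^ (-μ)) * ω (p 0) (p m) ^ μ := by
  have hω : 0 ≤ ω (p 0) (p m) ^ μ := Real.rpow_nonneg (h_nonneg _ _ (hp (Nat.zero_le m))) μ
  have hsummable : Summable fun l : ℕ => ((l : ℝ) + 1) ^ (-μ) := by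
    simpa using (summable_nat_add_iff 1).mpr (Real.summable_nat_rpow.mpr (by linarith : -μ < -1))
  have hpartial (N : ℕ) : ∑ l ∈ range N, ((l : ℝ) + 1) ^ (-μ) ≤ ∑' l : ℕ, ((l : ℝ) + 1) ^ (-μ) :=
    hsummable.sum_le_tsum _ fun l _ => by positivity
  have hone : 1 ≤ (2 : ℝ) ^ μ * ∑' l : ℕ, ((l : ℝ) + 1) ^ (-μ) :=
    one_le_mul_of_one_le_of_one_le (Real.one_le_rpow one_le_two (by linarith))
      (by simpa using hpartial 1)
  match m with
  | 0 =>
    have hd := h_delta _ _ _ (le_refl (p 0)) (le_refl (p 0))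
    rw [sub_self, zero_sub, norm_neg] at hd
    exact hd.trans (le_mul_of_one_le_left hω hone)
  | 1 => exact (h_step 0 one_pos).trans (le_mul_of_one_le_left hω hone)
  | m + 2 =>
    have hsum : ‖∑ k ∈ range (m + 2), R (p k) (p (k + 1))‖ ≤ ω (p 0) (p (m + 2)) ^ μ :=
      (norm_sum_le_of_le _ fun k hk => h_step k (mem_range.mp hk)).trans
        (control_sum_rpow_le h_nonneg h_super hp hμ.le (m + 2))
    calc ‖R (p 0) (p (m + 2))‖ ≤ _ := norm_le_norm_sub_add _ _
      _ ≤ _ := add_le_add (norm_sub_sum_steps_le hμ.le h_nonneg h_super h_delta m hp) hsum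
      _ = (2 ^ μ * ∑ l ∈ range (m + 1), ((l : ℝ) + 1) ^ (-μ)) * ω (p 0) (p (m + 2)) ^ μ := by ring
      _ ≤ _ := by gcongr; exact hpartial (m + 1)

end Control

/-- **Discrete sewing lemma.** Let `(B, ‖·‖)` be a normed vector space, let `n ≥ 1` and let
`t 0 < t 1 < ⋯ < t n` be real numbers forming a grid `G`. Let `ω` be a control on `G`
(nonnegative and superadditive on pairs of grid points), let `μ > 1`, and let `R` assign to
every pair of grid points `s ≤ t` an element of `B`. If `‖R (t k) (t (k+1))‖ ≤ ω(t k, t (k+1))^μ`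
for every step of the grid, and `‖R s t − R s u − R u t‖ ≤ ω(s,t)^μ` for all grid points
`s ≤ u ≤ t`, then `‖R s t‖ ≤ K_μ · ω(s,t)^μ` for all grid points `s ≤ t`, where
`K_μ = 2^μ · ∑_{l=1}^∞ l^{−μ}`. -/
theorem discrete_sewing_lemma
    {B : Type*} [NormedAddCommGroup B] [NormedSpace ℝ B]
    (n : ℕ) (hn : 1 ≤ n) (t : Fin (n + 1) → ℝ) (ht : StrictMono t)
    (μ : ℝ) (hμ : 1 < μ)
    (ω : ℝ → ℝ → ℝ) (R : ℝ → ℝ → B)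
    (hω_nonneg : ∀ i j : Fin (n + 1), i ≤ j → 0 ≤ ω (t i) (t j))
    (hω_super : ∀ i j k : Fin (n + 1), i ≤ j → j ≤ k →
      ω (t i) (t j) + ω (t j) (t k) ≤ ω (t i) (t k))
    (hR_step : ∀ k : Fin n,
      ‖R (t k.castSucc) (t k.succ)‖ ≤ ω (t k.castSucc) (t k.succ) ^ μ)
    (hR_delta : ∀ i j k : Fin (n + 1), i ≤ j → j ≤ k →
      ‖R (t i) (t k) - R (t i) (t j) - R (t j) (t k)‖ ≤ ω (t i) (t k) ^ μ) :
    ∀ i j : Fin (n + 1), i ≤ j →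
      ‖R (t i) (t j)‖ ≤
        ((2 : ℝ) ^ μ * ∑' l : ℕ, ((l : ℝ) + 1) ^ (-μ)) * ω (t i) (t j) ^ μ := by
  intro i j hij
  have hij' : (i : ℕ) ≤ j := hij
  let p : ℕ → Fin (n + 1) := fun k => ⟨min (i + k) j, by omega⟩
  have hp : Monotone p := fun a b hab => Fin.mk_le_mk.mpr (by omega)
  have hp0 : p 0 = i := Fin.ext (by simp [p, hij'])
  have hpm : p (j - i) = j := Fin.ext (by simp [p, hij'])
  have h := norm_le_of_norm_step_le (ω := fun a b => ω (t a) (t b)) (R := fun a b => R (t a) (t b))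
    hμ hω_nonneg hω_super hR_delta (j - i) hp fun k hk => by
      have hcast : p k = (⟨i + k, by omega⟩ : Fin n).castSucc := Fin.ext (by simp [p]; omega)
      have hsucc : p (k + 1) = (⟨i + k, by omega⟩ : Fin n).succ := Fin.ext (by simp [p]; omega)
      rw [hcast, hsucc]
      exact hR_step _
  rwa [hp0, hpm] at h
end

section
/- Tree-indexed Faà di Bruno formula (chain rule of Lemma 3.6, in its directional form): Let N ≥ 1, let f : ℝ^m → ℝ be N times continuously differentiable and let F : ℝ → ℝ^m be N times continuously differentiable. Then for every t ∈ ℝ, the N-th derivative of the composition f ∘ F at t equals the sum over all branches i ∈ A_N of the evaluations ∂^{ℓ_1^i} f(F(t))[F^{(ℓ_2^i)}(t), …, F^{(ℓ_{α_i}^i)}(t)], where F^{(ℓ)}(t) ∈ ℝ^m denotes the ℓ-th derivative of F at t. (Note that each summand is well defined because ∂^{ℓ_1^i} f(F(t)) is an ℓ_1^i-linear map and α_i − 1 = ℓ_1^i.) -/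
/-- A branch of length `N`: a sequence `i_1, …, i_N` of positive integers (encoded as a
function `ℕ → ℕ` vanishing outside `{1, …, N}`) such that `i_1 = 1` and, for every
`1 ≤ τ < N`, `i_{τ+1} ≤ 1 + #{σ ∈ {1,…,τ} : i_σ = 1}`.  `A_N` is the set of branches of
length `N`. -/
def IsBranch (N : ℕ) (i : ℕ → ℕ) : Prop :=
  i 1 = 1 ∧
  (∀ τ, 1 ≤ τ → τ ≤ N → 1 ≤ i τ) ∧
  (∀ τ, 1 ≤ τ → τ < N →
    i (τ + 1) ≤ 1 + ((Finset.Icc 1 τ).filter (fun σ => i σ = 1)).card) ∧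
  (∀ τ, τ = 0 ∨ N < τ → i τ = 0)

/-- `ell N i r = ℓ_r^i`: for `r = 1` the number of `1`'s in the branch `i` of length `N`,
and for `r ≥ 2` one plus the number of `r`'s in `i`. -/
def ell (N : ℕ) (i : ℕ → ℕ) (r : ℕ) : ℕ :=
  if r = 1 then ((Finset.Icc 1 N).filter (fun τ => i τ = 1)).card
  else 1 + ((Finset.Icc 1 N).filter (fun τ => i τ = r)).card

/-- `alpha N i = α_i = ℓ_1^i + 1`. -/
def alpha (N : ℕ) (i : ℕ → ℕ) : ℕ := ell N i 1 + 1

section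

open Finset

section FDeriv

variable {E G : Type*} [NormedAddCommGroup E] [NormedSpace ℝ E]
  [NormedAddCommGroup G] [NormedSpace ℝ G]

/-- The first argument of an iterated derivative may be moved to the last position. -/
theorem ContDiff.iteratedFDeriv_cons_eq_snoc {f : E → G} {k : ℕ}
    (hf : ContDiff ℝ (k + 1 : ℕ) f) (x : E) (a : E) (v : Fin k → E) :
    iteratedFDeriv ℝ (k + 1) f x (Fin.cons a v : Fin (k + 1) → E) =
      iteratedFDeriv ℝ (k + 1) f x (Fin.snoc v a : Fin (k + 1) → E) := by
  induction k generalizing x a with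
  | zero =>
    congr 1
    ext i
    fin_cases i
    rfl
  | succ k ih =>
    obtain ⟨b, w, rfl⟩ : ∃ b w, v = Fin.cons b w := ⟨v 0, Fin.tail v, (Fin.cons_self_tail v).symm⟩
    set g : E → G := fun y => iteratedFDeriv ℝ k f y w
    have hf' : ContDiff ℝ (k + 1 : ℕ) f := hf.of_le (by exact_mod_cast Nat.le_succ _)
    have hdiff : Differentiable ℝ (iteratedFDeriv ℝ k f) :=
      hf'.differentiable_iteratedFDeriv (by exact_mod_cast Nat.lt_succ_self _)
    have hdiff' : Differentiable ℝ (iteratedFDeriv ℝ (k + 1) f) :=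
      hf.differentiable_iteratedFDeriv (by exact_mod_cast Nat.lt_succ_self _)
    have hg : ContDiff ℝ 2 g := by
      have h : ContDiff ℝ 2 (iteratedFDeriv ℝ k f) :=
        hf.iteratedFDeriv_right (by exact_mod_cast (by omega : 2 + k ≤ k + 1 + 1))
      exact (ContinuousMultilinearMap.apply ℝ (fun _ : Fin k => E) G w).contDiff.comp h
    have hstep (c : E) (y : E) :
        iteratedFDeriv ℝ (k + 1) f y (Fin.cons c w : Fin (k + 1) → E) = fderiv ℝ g y c := by
      rw [(hdiff y).iteratedFDeriv_succ_apply_left']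
      simp [g]
    have hg' : Differentiable ℝ (fderiv ℝ g) :=
      (hg.fderiv_right (m := 1) (by norm_num)).differentiable (by norm_num)
    have hsnd (c d : E) :
        fderiv ℝ (fun y => fderiv ℝ g y c) x d = fderiv ℝ (fderiv ℝ g) x d c := by
      rw [fderiv_clm_apply (hg' x) (differentiableAt_const c)]
      simp
    rw [← Fin.cons_snoc_eq_snoc_cons, (hdiff' x).iteratedFDeriv_succ_apply_left',
      (hdiff' x).iteratedFDeriv_succ_apply_left']
    simp only [Fin.tail_cons, Fin.cons_zero, ← ih hf', hstep, hsnd]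
    exact (hg.contDiffAt.isSymmSndFDerivAt (by simp)).eq a b

/-- Derivative of `s ↦ ∂ᵏf(F s)[F^(l 0)(s), …, F^(l (k-1))(s)]`. -/
theorem hasDerivAt_iteratedFDeriv_comp_iteratedDeriv {f : E → G} {F : ℝ → E} {n k : ℕ}
    {l : ℕ → ℕ} (hf : ContDiff ℝ (n + 1 : ℕ) f) (hF : ContDiff ℝ (n + 1 : ℕ) F)
    (hk : k ≤ n) (hl : ∀ j < k, l j ≤ n) (t : ℝ) :
    HasDerivAt
      (fun s => iteratedFDeriv ℝ k f (F s) (fun j : Fin k => iteratedDeriv (l j) F s))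
      (iteratedFDeriv ℝ (k + 1) f (F t)
          (fun j : Fin (k + 1) => iteratedDeriv (Function.update l k 1 j) F t) +
        ∑ r : Fin k, iteratedFDeriv ℝ k f (F t)
          (fun j : Fin k => iteratedDeriv (Function.update l r (l r + 1) j) F t)) t := by
  have hFt : HasDerivAt F (deriv F t) t :=
    (hF.differentiable (by exact_mod_cast Nat.succ_ne_zero n) t).hasDerivAt
  have hfk : HasFDerivAt (iteratedFDeriv ℝ k f) (fderiv ℝ (iteratedFDeriv ℝ k f) (F t)) (F t) :=
    (hf.differentiable_iteratedFDeriv (by exact_mod_cast Nat.lt_succ_of_le hk) _).hasFDerivAt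
  have hFl (j : Fin k) : HasDerivAt (iteratedDeriv (l j) F) (iteratedDeriv (l j + 1) F t) t := by
    rw [iteratedDeriv_succ]
    exact (hF.differentiable_iteratedDeriv _
      (by exact_mod_cast Nat.lt_succ_of_le (hl j j.2)) t).hasDerivAt
  have key := ((hfk.comp t hFt.hasFDerivAt).continuousMultilinearMap_apply
    (fun j => (hFl j).hasFDerivAt)).hasDerivAt
  refine key.congr_deriv ?_
  have hfirst : (fun j : Fin (k + 1) => iteratedDeriv (Function.update l k 1 j) F t) =
      Fin.snoc (fun j : Fin k => iteratedDeriv (l j) F t) (deriv F t) := by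
    ext j
    refine Fin.lastCases ?_ (fun j => ?_) j
    · simp
    · simp [Function.update_of_ne j.2.ne]
  have hother (r : Fin k) :
      (fun j : Fin k => iteratedDeriv (Function.update l r (l r + 1) j) F t) =
        Function.update (fun j : Fin k => iteratedDeriv (l j) F t) r
          (iteratedDeriv (l r + 1) F t) := by
    ext j
    rcases eq_or_ne j r with rfl | h
    · simp
    · simp [h, Function.update_of_ne (Fin.val_injective.ne h)]
  rw [hfirst, ← (hf.of_le (by exact_mod_cast Nat.succ_le_succ hk)).iteratedFDeriv_cons_eq_snoc,
    iteratedFDeriv_succ_apply_left]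
  simp [hother]

theorem iteratedFDeriv_iteratedDeriv_congr (f : E → G) (F : ℝ → E) (t : ℝ) {k k' : ℕ}
    {l l' : ℕ → ℕ} (hk : k = k') (hl : ∀ j < k, l j = l' j) :
    iteratedFDeriv ℝ k f (F t) (fun j : Fin k => iteratedDeriv (l j) F t) =
      iteratedFDeriv ℝ k' f (F t) (fun j : Fin k' => iteratedDeriv (l' j) F t) := by
  subst hk
  congr 1
  ext j
  rw [hl j j.2]

end FDeriv

theorem ell_one_eq (N : ℕ) (i : ℕ → ℕ) :
    ell N i 1 = #{τ ∈ Icc 1 N | i τ = 1} := rfl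

theorem card_filter_Icc_update (N : ℕ) (i : ℕ → ℕ) (r s : ℕ) :
    #{τ ∈ Icc 1 (N + 1) | Function.update i (N + 1) r τ = s} =
      #{τ ∈ Icc 1 N | i τ = s} + if r = s then 1 else 0 := by
  have h : ∀ τ ∈ Icc 1 N, Function.update i (N + 1) r τ = i τ := fun τ hτ =>
    Function.update_of_ne (by simp at hτ; omega) _ _
  rw [← insert_Icc_right_eq_Icc_add_one (by omega), filter_insert,
    filter_congr (fun τ hτ => by rw [h τ hτ])]
  split_ifs <;> simp_all

theorem ell_update (N : ℕ) (i : ℕ → ℕ) (r s : ℕ) :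
    ell (N + 1) (Function.update i (N + 1) r) s = ell N i s + if r = s then 1 else 0 := by
  unfold ell
  rw [card_filter_Icc_update, card_filter_Icc_update]
  split_ifs <;> simp_all [add_assoc]

theorem ell_one_le (N : ℕ) (i : ℕ → ℕ) : ell N i 1 ≤ N := by
  rw [ell_one_eq]
  exact (card_filter_le _ _).trans (by simp)

theorem IsBranch.ell_le {N : ℕ} {i : ℕ → ℕ} (hi : IsBranch N i) (hN : 1 ≤ N) {r : ℕ}
    (hr : r ≠ 1) : ell N i r ≤ N := by
  have hlt : #{τ ∈ Icc 1 N | i τ = r} < #(Icc 1 N) := by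
    refine card_lt_card (filter_ssubset.2 ⟨1, by simp [hN], ?_⟩)
    rw [hi.1]
    exact hr.symm
  simp only [Nat.card_Icc, add_tsub_cancel_right] at hlt
  simp only [ell, hr, if_false]
  omega

theorem IsBranch.apply_le {N : ℕ} {i : ℕ → ℕ} (hi : IsBranch N i) {τ : ℕ} (hτ : τ ∈ Icc 1 N) :
    i τ ≤ ell N i 1 + 1 := by
  obtain ⟨h1, h2⟩ := mem_Icc.1 hτ
  rcases h1.eq_or_lt with rfl | h1
  · rw [hi.1]
    omega
  · obtain ⟨σ, rfl⟩ : ∃ σ, τ = σ + 1 := ⟨τ - 1, by omega⟩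
    refine (hi.2.2.1 σ (by omega) (by omega)).trans ?_
    rw [add_comm, ell_one_eq]
    gcongr
    omega

/-- No entry of a branch exceeds `ℓ_1 + 1`, so `ℓ_{ℓ_1 + 2} = 1`. -/
theorem IsBranch.ell_eq_one {N : ℕ} {i : ℕ → ℕ} (hi : IsBranch N i) :
    ell N i (ell N i 1 + 2) = 1 := by
  rw [ell, if_neg (by omega), filter_false_of_mem, card_empty]
  intro τ hτ
  have := hi.apply_le hτ
  omega

theorem isBranch_one_iff (i : ℕ → ℕ) : IsBranch 1 i ↔ i = Pi.single 1 1 := by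
  constructor
  · rintro ⟨h1, -, -, h0⟩
    ext τ
    rcases eq_or_ne τ 1 with rfl | h
    · simp [h1]
    · simp [h, h0 τ (by omega)]
  · rintro rfl
    refine ⟨by simp, fun τ h1 h2 => ?_, fun τ h1 h2 => by omega, fun τ h => ?_⟩
    · obtain rfl : τ = 1 := by omega
      simp
    · exact Pi.single_eq_of_ne (by omega) _

theorem isBranch_succ_iff {N : ℕ} (hN : 1 ≤ N) (i : ℕ → ℕ) :
    IsBranch (N + 1) i ↔
      ∃ j, IsBranch N j ∧ ∃ r < ell N j 1 + 1, i = Function.update j (N + 1) (r + 1) := by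
  have hcard (j : ℕ → ℕ) (r τ : ℕ) (hτ : τ ≤ N) :
      #{σ ∈ Icc 1 τ | Function.update j (N + 1) r σ = 1} = #{σ ∈ Icc 1 τ | j σ = 1} := by
    congr 1
    refine filter_congr fun σ hσ => ?_
    rw [Function.update_of_ne (by simp at hσ; omega)]
  constructor
  · rintro ⟨h1, hpos, hle, h0⟩
    refine ⟨Function.update i (N + 1) 0, ⟨?_, fun τ h1 h2 => ?_, fun τ h1 h2 => ?_, fun τ h => ?_⟩,
      i (N + 1) - 1, ?_, ?_⟩
    · rwa [Function.update_of_ne (by omega)]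
    · rw [Function.update_of_ne (by omega)]
      exact hpos τ h1 (by omega)
    · rw [Function.update_of_ne (by omega), hcard _ _ _ (by omega)]
      exact hle τ h1 (by omega)
    · rcases eq_or_ne τ (N + 1) with rfl | h'
      · simp
      · rw [Function.update_of_ne h']
        exact h0 τ (by omega)
    · have := hle N hN (by omega)
      have := hpos (N + 1) (by omega) le_rfl
      rw [ell_one_eq, hcard _ _ _ le_rfl]
      omega
    · have := hpos (N + 1) (by omega) le_rfl
      rw [Nat.sub_add_cancel this]
      simp
  · rintro ⟨j, ⟨h1, hpos, hle, h0⟩, r, hr, rfl⟩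
    refine ⟨?_, fun τ h1 h2 => ?_, fun τ h1 h2 => ?_, fun τ h => ?_⟩
    · rwa [Function.update_of_ne (by omega)]
    · rcases eq_or_ne τ (N + 1) with rfl | h'
      · simp
      · rw [Function.update_of_ne h']
        exact hpos τ h1 (by omega)
    · rw [hcard _ _ _ (by omega)]
      rcases eq_or_ne τ N with rfl | h'
      · rw [Function.update_self]
        rw [ell_one_eq] at hr
        omega
      · rw [Function.update_of_ne (by omega)]
        exact hle τ h1 (by omega)
    · rw [Function.update_of_ne (by omega)]
      exact h0 τ (by omega)

open Classical in
/-- The finite set of branches of length `n + 1`, each obtained from a branch of length `n` by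
appending a value. -/
noncomputable def branches : ℕ → Finset (ℕ → ℕ)
  | 0 => {Pi.single 1 1}
  | n + 1 => (branches n).biUnion fun i =>
      (range (ell (n + 1) i 1 + 1)).image fun r => Function.update i (n + 2) (r + 1)

theorem mem_branches {n : ℕ} {i : ℕ → ℕ} : i ∈ branches n ↔ IsBranch (n + 1) i := by
  induction n generalizing i with
  | zero => simp [branches, isBranch_one_iff]
  | succ n ih =>
    rw [isBranch_succ_iff (by omega)]
    simp [branches, ih, eq_comm]

theorem sum_branches_succ {M : Type*} [AddCommMonoid M] (n : ℕ) (g : (ℕ → ℕ) → M) :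
    ∑ i ∈ branches (n + 1), g i =
      ∑ i ∈ branches n, ∑ r ∈ range (ell (n + 1) i 1 + 1),
        g (Function.update i (n + 2) (r + 1)) := by
  classical
  rw [branches, sum_biUnion]
  · refine sum_congr rfl fun i _ => ?_
    rw [sum_image]
    intro r _ s _ h
    simpa using congrFun h (n + 2)
  · intro i hi j hj hij
    refine Finset.disjoint_left.2 fun x hx hx' => hij ?_
    obtain ⟨r, -, rfl⟩ := mem_image.1 hx
    obtain ⟨s, -, h⟩ := mem_image.1 hx'
    ext τ
    rcases eq_or_ne τ (n + 2) with rfl | hτ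
    · rw [(mem_branches.1 hi).2.2.2 _ (by omega), (mem_branches.1 hj).2.2.2 _ (by omega)]
    · simpa [hτ] using (congrFun h τ).symm

theorem iteratedDeriv_comp_eq_sum_branches {E G : Type*} [NormedAddCommGroup E] [NormedSpace ℝ E]
    [NormedAddCommGroup G] [NormedSpace ℝ G] {f : E → G} {F : ℝ → E} (n : ℕ)
    (hf : ContDiff ℝ (n + 1 : ℕ) f) (hF : ContDiff ℝ (n + 1 : ℕ) F) (t : ℝ) :
    iteratedDeriv (n + 1) (fun s => f (F s)) t =
      ∑ i ∈ branches n, iteratedFDeriv ℝ (ell (n + 1) i 1) f (F t)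
        (fun j => iteratedDeriv (ell (n + 1) i ((j : ℕ) + 2)) F t) := by
  induction n generalizing t with
  | zero =>
    have hlen : ell 1 (Pi.single 1 1) 1 = 1 := by simp [ell, filter_singleton]
    have hexp : ell 1 (Pi.single 1 1) 2 = 1 := by simp [ell, filter_singleton]
    have hone : 0 + 1 ≠ 0 := by norm_num
    have hcomp := ((hf.differentiable (by exact_mod_cast hone) (F t)).hasFDerivAt.comp_hasDerivAt t
      (hF.differentiable (by exact_mod_cast hone) t).hasDerivAt).deriv
    rw [branches, sum_singleton,
      iteratedFDeriv_iteratedDeriv_congr f F t (l := fun j => ell 1 (Pi.single 1 1) (j + 2)) (l' := fun _ => 1) hlen fun j hj => by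
        obtain rfl : j = 0 := by omega
        exact hexp]
    simpa [Function.comp_def] using hcomp
  | succ n ih =>
    have hle : n + 1 ≤ n + 1 + 1 := Nat.le_succ _
    rw [iteratedDeriv_succ,
      funext (ih (hf.of_le (by exact_mod_cast hle)) (hF.of_le (by exact_mod_cast hle))),
      sum_branches_succ]
    refine (HasDerivAt.fun_sum fun i hi => ?_).deriv
    have hbr := mem_branches.1 hi
    refine (hasDerivAt_iteratedFDeriv_comp_iteratedDeriv (l := fun j => ell (n + 1) i (j + 2))
      hf hF (ell_one_le _ _) (fun j _ => hbr.ell_le (by omega) (by omega)) t).congr_deriv ?_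
    rw [sum_range_succ', add_comm, sum_range]
    congr 1
    · refine sum_congr rfl fun r _ => ?_
      refine iteratedFDeriv_iteratedDeriv_congr f F t (l' := fun j => ell (n + 2) (Function.update i (n + 2) (r + 1 + 1)) (j + 2))
        (by simp [ell_update]) fun j _ => ?_
      simp only [ell_update, Function.update_apply]
      split_ifs <;> first | omega | simp_all
    · refine iteratedFDeriv_iteratedDeriv_congr f F t (l' := fun j => ell (n + 2) (Function.update i (n + 2) (0 + 1)) (j + 2))
        (by simp [ell_update]) fun j _ => ?_
      simp only [ell_update, Function.update_apply]
      split_ifs with h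
      · omega
      · subst h
        simpa using hbr.ell_eq_one.symm
      · omega
      · rfl

end

/-- **Tree-indexed Faà di Bruno formula** (directional chain rule of Lemma 3.6):
if `f : ℝ^m → ℝ` and `F : ℝ → ℝ^m` are `N` times continuously differentiable, then the `N`-th
derivative of `f ∘ F` at `t` equals the sum over all branches `i ∈ A_N` of
`∂^{ℓ_1^i} f(F t)[F^{(ℓ_2^i)}(t), …, F^{(ℓ_{α_i}^i)}(t)]`.  The `ℓ_1^i` vector arguments are
indexed by `j : Fin ℓ_1^i`, the `j`-th one being the `ℓ_{j+2}^i`-th derivative of `F` at `t`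
(recall `α_i − 1 = ℓ_1^i`). -/
theorem tree_faa_di_bruno (N m : ℕ) (hN : 1 ≤ N)
    (f : (Fin m → ℝ) → ℝ) (F : ℝ → Fin m → ℝ)
    (hf : ContDiff ℝ N f) (hF : ContDiff ℝ N F) (t : ℝ) :
    iteratedDeriv N (fun s => f (F s)) t =
      ∑ᶠ i ∈ {i : ℕ → ℕ | IsBranch N i},
        iteratedFDeriv ℝ (ell N i 1) f (F t)
          (fun j : Fin (ell N i 1) => iteratedDeriv (ell N i ((j : ℕ) + 2)) F t) := by
  obtain ⟨n, rfl⟩ : ∃ n, N = n + 1 := ⟨N - 1, by omega⟩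
  have hset : {i : ℕ → ℕ | IsBranch (n + 1) i} = ↑(branches n) := by
    ext i
    exact mem_branches.symm
  rw [hset, finsum_mem_coe_finset]
  exact iteratedDeriv_comp_eq_sum_branches n (by exact_mod_cast hf) (by exact_mod_cast hF) t
end

section
/- Increment bound for tensor products (Lemma 4.3): Let N ≥ 1, m ≥ 1 and 1 ≤ L_0 ≤ N be integers, and let ℓ_1, …, ℓ_{N'} be positive integers with ℓ_1 + ⋯ + ℓ_{N'} = L_0. For each ℓ ∈ {1, …, N} let Ξ^ℓ_s, Ξ^ℓ_u ∈ ℝ^m, let ε be a real number with 0 ≤ ε ≤ 1/2, and let K^1, …, K^N be real constants with K^ℓ ≥ 1. Set a_ℓ = max_{1 ≤ j ≤ m} |Ξ^{ℓ,(j)}_s| (the max-norm of Ξ^ℓ_s) and P^L_s = P^L(a). Assume that max_{1 ≤ j ≤ m} |Ξ^{ℓ,(j)}_u − Ξ^{ℓ,(j)}_s| ≤ K^ℓ · P^ℓ_s · ε for every ℓ ∈ {1, …, N}. Then for every choice of coordinates p_1, …, p_{N'} ∈ {1, …, m} one has |∏_{j=1}^{N'} Ξ^{ℓ_j,(p_j)}_u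 − ∏_{j=1}^{N'} Ξ^{ℓ_j,(p_j)}_s| ≤ C^4_{L_0} · P^{L_0}_s · ε, where C^4_{L_0} = max { 2^{L_0+1} · K^{q_1} ⋯ K^{q_k} : k ≥ 1, q_1, …, q_k positive integers with q_1 + ⋯ + q_k = L_0 }. -/
/-- `Pmax a L = P^L(a)`: the maximum of `1` and of all products `a_{q_1} ⋯ a_{q_k}` over
nonempty tuples `(q_1, …, q_k)` of positive integers with `q_1 + ⋯ + q_k ≤ L`; in
particular `Pmax a 0 = 1`. -/
noncomputable def Pmax (a : ℕ → ℝ) (L : ℕ) : ℝ :=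
  sSup (insert (1 : ℝ)
    {x : ℝ | ∃ l : List ℕ, l ≠ [] ∧ (∀ q ∈ l, 1 ≤ q) ∧ l.sum ≤ L ∧ x = (l.map a).prod})

/-- `C^4_{L₀} = max { 2^{L₀+1} · K_{q_1} ⋯ K_{q_k} }`, the maximum running over nonempty
tuples `(q_1, …, q_k)` of positive integers with `q_1 + ⋯ + q_k = L₀`. -/
noncomputable def CfourConst (K : ℕ → ℝ) (L₀ : ℕ) : ℝ :=
  sSup {x : ℝ | ∃ l : List ℕ, l ≠ [] ∧ (∀ q ∈ l, 1 ≤ q) ∧ l.sum = L₀ ∧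
    x = 2 ^ (L₀ + 1) * (l.map K).prod}

theorem finite_positive_lists_sum_le (L : ℕ) :
    {l : List ℕ | (∀ q ∈ l, 1 ≤ q) ∧ l.sum ≤ L}.Finite := by
  refine ((Set.finite_Iic L).biUnion
    fun n _ => Set.finite_range (Composition.blocks (n := n))).subset ?_
  rintro l ⟨hpos, hsum⟩
  exact Set.mem_biUnion hsum ⟨⟨l, fun h => hpos _ h, rfl⟩, rfl⟩

theorem Pmax_set_finite (a : ℕ → ℝ) (L : ℕ) :
    (insert (1 : ℝ) {x : ℝ | ∃ l : List ℕ, l ≠ [] ∧ (∀ q ∈ l, 1 ≤ q) ∧ l.sum ≤ L ∧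
      x = (l.map a).prod}).Finite := by
  refine (((finite_positive_lists_sum_le L).image fun l => (l.map a).prod).subset ?_).insert 1
  rintro x ⟨l, -, hpos, hsum, rfl⟩
  exact ⟨l, ⟨hpos, hsum⟩, rfl⟩

theorem prod_le_Pmax (a : ℕ → ℝ) {L : ℕ} {l : List ℕ} (hpos : ∀ q ∈ l, 1 ≤ q)
    (hsum : l.sum ≤ L) : (l.map a).prod ≤ Pmax a L := by
  refine le_csSup (Pmax_set_finite a L).bddAbove ?_
  rcases eq_or_ne l [] with rfl | hl
  · simp
  · exact Or.inr ⟨l, hl, hpos, hsum, rfl⟩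

theorem exists_prod_eq_Pmax (a : ℕ → ℝ) (L : ℕ) :
    ∃ l : List ℕ, (∀ q ∈ l, 1 ≤ q) ∧ l.sum ≤ L ∧ Pmax a L = (l.map a).prod := by
  rcases (Set.insert_nonempty _ _).csSup_mem (Pmax_set_finite a L) with h | ⟨l, -, h⟩
  · exact ⟨[], by simp, by simp, by simpa [Pmax] using h⟩
  · exact ⟨l, h⟩

theorem one_le_Pmax (a : ℕ → ℝ) (L : ℕ) : 1 ≤ Pmax a L := by
  simpa using prod_le_Pmax a (L := L) (l := []) (by simp) (by simp)

theorem le_Pmax (a : ℕ → ℝ) {q : ℕ} (hq : 1 ≤ q) : a q ≤ Pmax a q := by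
  simpa using prod_le_Pmax a (L := q) (l := [q]) (by simpa using hq) (by simp)

theorem Pmax_mul_le (a : ℕ → ℝ) (L M : ℕ) : Pmax a L * Pmax a M ≤ Pmax a (L + M) := by
  obtain ⟨l, hl, hls, hle⟩ := exists_prod_eq_Pmax a L
  obtain ⟨k, hk, hks, hke⟩ := exists_prod_eq_Pmax a M
  rw [hle, hke, ← List.prod_append, ← List.map_append]
  refine prod_le_Pmax a (fun q hq => ?_) ?_
  · exact (List.mem_append.mp hq).elim (hl q) (hk q)
  · rw [List.sum_append]
    exact add_le_add hls hks

theorem prod_Pmax_le {ι : Type*} (a : ℕ → ℝ) (s : Finset ι) (ℓ : ι → ℕ) :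
    ∏ j ∈ s, Pmax a (ℓ j) ≤ Pmax a (∑ j ∈ s, ℓ j) := by
  classical
  induction s using Finset.induction_on with
  | empty => simpa using one_le_Pmax a 0
  | insert i s hi ih =>
    rw [Finset.prod_insert hi, Finset.sum_insert hi]
    exact (mul_le_mul_of_nonneg_left ih (zero_le_one.trans (one_le_Pmax a _))).trans
      (Pmax_mul_le a _ _)

theorem le_CfourConst (K : ℕ → ℝ) {L : ℕ} {l : List ℕ} (hl : l ≠ [])
    (hpos : ∀ q ∈ l, 1 ≤ q) (hsum : l.sum = L) :
    2 ^ (L + 1) * (l.map K).prod ≤ CfourConst K L := by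
  refine le_csSup (Set.Finite.bddAbove ?_) ⟨l, hl, hpos, hsum, rfl⟩
  refine ((finite_positive_lists_sum_le L).image
    fun l => 2 ^ (L + 1) * (l.map K).prod).subset ?_
  rintro x ⟨k, -, hk, hks, rfl⟩
  exact ⟨k, ⟨hk, hks.le⟩, rfl⟩

theorem abs_prod_sub_prod_le {ι : Type*} (t : Finset ι) {u s P κ : ι → ℝ} {ε : ℝ}
    (hε0 : 0 ≤ ε) (hε1 : ε ≤ 1) (hκ : ∀ j ∈ t, 1 ≤ κ j) (hs : ∀ j ∈ t, |s j| ≤ P j)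
    (hus : ∀ j ∈ t, |u j - s j| ≤ κ j * P j * ε) :
    |∏ j ∈ t, u j - ∏ j ∈ t, s j| ≤ (2 ^ t.card - 1) * (∏ j ∈ t, κ j * P j) * ε := by
  classical
  induction t using Finset.induction_on with
  | empty => simp
  | insert i t hi ih =>
    simp only [Finset.forall_mem_insert] at hκ hs hus
    obtain ⟨hκi, hκ⟩ := hκ
    obtain ⟨hsi, hs⟩ := hs
    obtain ⟨husi, hus⟩ := hus
    have ih := ih hκ hs hus
    rw [Finset.prod_insert hi, Finset.prod_insert hi, Finset.prod_insert hi,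
      Finset.card_insert_of_notMem hi]
    have hPi : 0 ≤ P i := (abs_nonneg _).trans hsi
    have hPκ : P i ≤ κ i * P i := le_mul_of_one_le_left hPi hκi
    have hui : |u i| ≤ 2 * (κ i * P i) := by
      have h1 : |u i| ≤ |u i - s i| + |s i| := by
        simpa using abs_add_le (u i - s i) (s i)
      have h2 : κ i * P i * ε ≤ κ i * P i := mul_le_of_le_one_right (hPi.trans hPκ) hε1
      linarith
    have hS : |∏ j ∈ t, s j| ≤ ∏ j ∈ t, κ j * P j := by
      rw [Finset.abs_prod]
      exact Finset.prod_le_prod (fun _ _ => abs_nonneg _) fun j hj => (hs j hj).trans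
        (le_mul_of_one_le_left ((abs_nonneg _).trans (hs j hj)) (hκ j hj))
    calc |u i * ∏ j ∈ t, u j - s i * ∏ j ∈ t, s j|
        = |u i * (∏ j ∈ t, u j - ∏ j ∈ t, s j) + (u i - s i) * ∏ j ∈ t, s j| := by
          congr 1; ring
      _ ≤ |u i| * |∏ j ∈ t, u j - ∏ j ∈ t, s j| + |u i - s i| * |∏ j ∈ t, s j| := by
          rw [← abs_mul, ← abs_mul]; exact abs_add_le _ _
      _ ≤ 2 * (κ i * P i) * ((2 ^ t.card - 1) * (∏ j ∈ t, κ j * P j) * ε)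
          + κ i * P i * ε * ∏ j ∈ t, κ j * P j := by
          gcongr
      _ = (2 ^ (t.card + 1) - 1) * (κ i * P i * ∏ j ∈ t, κ j * P j) * ε := by ring

/-- **Increment bound for tensor products (Lemma 4.3).** With `a_ℓ = max_j |Ξ^{ℓ,(j)}_s|`
(the max-norm of `Ξ^ℓ_s`, i.e. the sup-norm `‖Ξ^ℓ_s‖` on `Fin m → ℝ`), `0 ≤ ε ≤ 1/2`,
constants `K^ℓ ≥ 1`, and `max_j |Ξ^{ℓ,(j)}_u − Ξ^{ℓ,(j)}_s| ≤ K^ℓ · P^ℓ(a) · ε` for every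
`1 ≤ ℓ ≤ N`, every choice of coordinates `p_1, …, p_{N'}` with `ℓ_1 + ⋯ + ℓ_{N'} = L₀`
satisfies `|∏_j Ξ^{ℓ_j,(p_j)}_u − ∏_j Ξ^{ℓ_j,(p_j)}_s| ≤ C^4_{L₀} · P^{L₀}(a) · ε`. -/
theorem tensor_product_increment_bound
    (N m L₀ N' : ℕ) (hN : 1 ≤ N) (hm : 1 ≤ m) (hL₀ : 1 ≤ L₀) (hL₀N : L₀ ≤ N)
    (ℓ : Fin N' → ℕ) (hℓpos : ∀ j, 1 ≤ ℓ j) (hℓsum : ∑ j, ℓ j = L₀)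
    (Ξs Ξu : ℕ → Fin m → ℝ)
    (ε : ℝ) (hε0 : 0 ≤ ε) (hε : ε ≤ 1 / 2)
    (K : ℕ → ℝ) (hK : ∀ q, 1 ≤ q → q ≤ N → 1 ≤ K q)
    (hΞ : ∀ q, 1 ≤ q → q ≤ N →
      ‖Ξu q - Ξs q‖ ≤ K q * Pmax (fun q' => ‖Ξs q'‖) q * ε)
    (p : Fin N' → Fin m) :
    |(∏ j, Ξu (ℓ j) (p j)) - ∏ j, Ξs (ℓ j) (p j)| ≤
      CfourConst K L₀ * Pmax (fun q' => ‖Ξs q'‖) L₀ * ε := by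
  set a : ℕ → ℝ := fun q' => ‖Ξs q'‖
  have hℓN : ∀ j, ℓ j ≤ N := fun j =>
    ((Finset.single_le_sum (fun _ _ => Nat.zero_le _) (Finset.mem_univ j)).trans
      hℓsum.le).trans hL₀N
  have hcard : N' ≤ L₀ := by
    simpa [hℓsum] using Finset.card_nsmul_le_sum Finset.univ ℓ 1 fun j _ => hℓpos j
  have hne : List.ofFn ℓ ≠ [] := by
    rintro h
    have : L₀ = 0 := by rw [← hℓsum, ← List.sum_ofFn, h, List.sum_nil]
    omega
  have hC : 2 ^ (L₀ + 1) * ∏ j, K (ℓ j) ≤ CfourConst K L₀ := by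
    have h := le_CfourConst K hne (by simpa [List.mem_ofFn] using hℓpos)
      ((List.sum_ofFn).trans hℓsum)
    simpa [List.map_ofFn, List.prod_ofFn] using h
  have hKprod : 0 ≤ ∏ j, K (ℓ j) := Finset.prod_nonneg fun j _ =>
    zero_le_one.trans (hK _ (hℓpos j) (hℓN j))
  have hPprod : 0 ≤ ∏ j, Pmax a (ℓ j) := Finset.prod_nonneg fun j _ =>
    zero_le_one.trans (one_le_Pmax a _)
  have hP : ∏ j, Pmax a (ℓ j) ≤ Pmax a L₀ := hℓsum ▸ prod_Pmax_le a Finset.univ ℓ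
  have hpow : (2 : ℝ) ^ N' - 1 ≤ 2 ^ (L₀ + 1) := by
    have : (2 : ℝ) ^ N' ≤ 2 ^ (L₀ + 1) := pow_le_pow_right₀ one_le_two (by omega)
    linarith
  calc |(∏ j, Ξu (ℓ j) (p j)) - ∏ j, Ξs (ℓ j) (p j)|
      ≤ (2 ^ N' - 1) * (∏ j, K (ℓ j) * Pmax a (ℓ j)) * ε := by
        simpa using abs_prod_sub_prod_le Finset.univ (P := fun j => Pmax a (ℓ j)) hε0
          (hε.trans (by norm_num)) (fun j _ => hK _ (hℓpos j) (hℓN j))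
          (fun j _ => (norm_le_pi_norm (Ξs (ℓ j)) (p j)).trans (le_Pmax a (hℓpos j)))
          (fun j _ => (norm_le_pi_norm (Ξu (ℓ j) - Ξs (ℓ j)) (p j)).trans
            (hΞ _ (hℓpos j) (hℓN j)))
    _ = (2 ^ N' - 1) * (∏ j, K (ℓ j)) * (∏ j, Pmax a (ℓ j)) * ε := by
        rw [Finset.prod_mul_distrib]; ring
    _ ≤ 2 ^ (L₀ + 1) * (∏ j, K (ℓ j)) * (∏ j, Pmax a (ℓ j)) * ε := by gcongr
    _ ≤ CfourConst K L₀ * Pmax a L₀ * ε := by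
        gcongr
        exact le_trans (by positivity) hC
end

section
/- Second-order increment bound for derivatives along a controlled path (Lemma 4.5): Let N ≥ 0 and let V : ℝ^m → L(ℝ^d, ℝ^m) be (N+2) times continuously differentiable with sup_{y ∈ ℝ^m} ‖∂^τ V(y)‖ ≤ C^0 for every 0 ≤ τ ≤ N+2. Let y_s, y_u ∈ ℝ^m, δx ∈ ℝ^d, let ε ≥ 0, K_1 ≥ 0, K_2 ≥ 0 be real numbers, and assume ‖y_u − y_s‖ ≤ K_1·ε and ‖y_u − y_s − V(y_s)(δx)‖ ≤ K_2·ε². Then for every integer 0 ≤ L ≤ N one has ‖∂^L V(y_u) − ∂^L V(y_s) − ∂^{L+1} V(y_s)[V(y_s)(δx)]‖ ≤ C^0 · (K_1·K_1 + K_2) · ε², where ∂^{L+1} V(y_s)[v] denotes the continuous L-linear map obtained by evaluating the (L+1)-st Fréchet derivative of V at y_s in one argument equal to v ∈ ℝ^m. -/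
/-- The derivatives of order `n` of a function whose derivative of order `n + 1` is bounded by `C`
are `C`-Lipschitz. -/
theorem norm_iteratedFDeriv_sub_le {E F : Type*} [NormedAddCommGroup E] [NormedSpace ℝ E]
    [NormedAddCommGroup F] [NormedSpace ℝ F] {f : E → F} {n : ℕ} {C : ℝ}
    (hf : ContDiff ℝ (n + 1 : ℕ) f) (hC : ∀ z, ‖iteratedFDeriv ℝ (n + 1) f z‖ ≤ C) (x y : E) :
    ‖iteratedFDeriv ℝ n f y - iteratedFDeriv ℝ n f x‖ ≤ C * ‖y - x‖ :=
  convex_univ.norm_image_sub_le_of_norm_fderiv_le (𝕜 := ℝ)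
    (fun z _ => hf.differentiable_iteratedFDeriv (mod_cast n.lt_succ_self) z)
    (fun z _ => norm_fderiv_iteratedFDeriv.trans_le (hC z)) (Set.mem_univ x) (Set.mem_univ y)

/-- First-order Taylor estimate for the derivative of order `n` of a function whose derivative of
order `n + 2` is bounded by `C`. -/
theorem norm_iteratedFDeriv_sub_sub_curryLeft_le {E F : Type*} [NormedAddCommGroup E]
    [NormedSpace ℝ E] [NormedAddCommGroup F] [NormedSpace ℝ F] {f : E → F} {n : ℕ} {C : ℝ}
    (hf : ContDiff ℝ (n + 2 : ℕ) f) (hC : ∀ z, ‖iteratedFDeriv ℝ (n + 2) f z‖ ≤ C) (x y : E) :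
    ‖iteratedFDeriv ℝ n f y - iteratedFDeriv ℝ n f x -
        (iteratedFDeriv ℝ (n + 1) f x).curryLeft (y - x)‖ ≤ C * ‖y - x‖ * ‖y - x‖ := by
  have hC0 : 0 ≤ C := (norm_nonneg _).trans (hC x)
  refine (convex_closedBall x ‖y - x‖).norm_image_sub_le_of_norm_fderiv_le' (𝕜 := ℝ)
    (φ := fderiv ℝ (iteratedFDeriv ℝ n f) x)
    (fun z _ => hf.differentiable_iteratedFDeriv (by norm_cast; omega) z) (fun z hz => ?_)
    (Metric.mem_closedBall_self (norm_nonneg _)) (mem_closedBall_iff_norm.2 le_rfl)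
  rw [fderiv_iteratedFDeriv, Function.comp_apply, Function.comp_apply,
    ← LinearIsometryEquiv.map_sub, LinearIsometryEquiv.norm_map]
  exact (norm_iteratedFDeriv_sub_le hf hC x z).trans
    (mul_le_mul_of_nonneg_left (mem_closedBall_iff_norm.1 hz) hC0)


/-- **Second-order increment bound for derivatives along a controlled path (Lemma 4.5).**
Let `V : ℝ^m → L(ℝ^d, ℝ^m)` be `(N+2)` times continuously differentiable with
`‖∂^τ V(y)‖ ≤ C⁰` for all `y` and all `0 ≤ τ ≤ N+2`.  If `‖y_u − y_s‖ ≤ K₁·ε` and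
`‖y_u − y_s − V(y_s)(δx)‖ ≤ K₂·ε²`, then for every `0 ≤ L ≤ N`,
`‖∂^L V(y_u) − ∂^L V(y_s) − ∂^{L+1} V(y_s)[V(y_s)(δx)]‖ ≤ C⁰·(K₁·K₁ + K₂)·ε²`, where
`∂^{L+1} V(y_s)[v]` is the `L`-linear map obtained by evaluating the `(L+1)`-st Fréchet
derivative of `V` at `y_s` in one argument equal to `v`. -/
theorem iteratedFDeriv_second_order_increment_bound
    (N m d : ℕ) (V : (Fin m → ℝ) → ((Fin d → ℝ) →L[ℝ] (Fin m → ℝ))) (C0 : ℝ)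
    (hV : ContDiff ℝ (N + 2) V)
    (hC : ∀ τ : ℕ, τ ≤ N + 2 → ∀ y, ‖iteratedFDeriv ℝ τ V y‖ ≤ C0)
    (ys yu : Fin m → ℝ) (δx : Fin d → ℝ)
    (ε K1 K2 : ℝ) (hε : 0 ≤ ε) (hK1 : 0 ≤ K1) (hK2 : 0 ≤ K2)
    (h1 : ‖yu - ys‖ ≤ K1 * ε)
    (h2 : ‖yu - ys - V ys δx‖ ≤ K2 * ε ^ 2)
    (L : ℕ) (hL : L ≤ N) :
    ‖iteratedFDeriv ℝ L V yu - iteratedFDeriv ℝ L V ys -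
        (iteratedFDeriv ℝ (L + 1) V ys).curryLeft (V ys δx)‖ ≤
      C0 * (K1 * K1 + K2) * ε ^ 2 := by
  have hC0 : 0 ≤ C0 := (norm_nonneg _).trans (hC 0 (Nat.zero_le _) ys)
  have taylor := norm_iteratedFDeriv_sub_sub_curryLeft_le (n := L)
    (hV.of_le (by norm_cast; omega)) (hC (L + 2) (by omega)) ys yu
  set D := (iteratedFDeriv ℝ (L + 1) V ys).curryLeft with hD
  have hDnorm : ‖D‖ ≤ C0 := by
    rw [hD, ContinuousMultilinearMap.curryLeft_norm]
    exact hC (L + 1) (by omega) ys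
  have split : iteratedFDeriv ℝ L V yu - iteratedFDeriv ℝ L V ys - D (V ys δx) =
      (iteratedFDeriv ℝ L V yu - iteratedFDeriv ℝ L V ys - D (yu - ys)) +
        D (yu - ys - V ys δx) := by
    rw [map_sub D (yu - ys)]
    abel
  rw [split]
  calc
    _ ≤ C0 * ‖yu - ys‖ * ‖yu - ys‖ + C0 * ‖yu - ys - V ys δx‖ :=
      norm_add_le_of_le taylor (D.le_of_opNorm_le hDnorm _)
    _ ≤ C0 * (K1 * ε) * (K1 * ε) + C0 * (K2 * ε ^ 2) := by gcongr
    _ = C0 * (K1 * K1 + K2) * ε ^ 2 := by ring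
end
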